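/- Let T be an ℝ-tree and let G be a group with a non-nesting action on T by weak homeomorphisms. Let h, h' ∈ G be loxodromic, let a ∈ L_h, and suppose there exists a' ∈ T with [a', (h')²(a')] ⊆ [a, h(a)]. Then h and h' are not conjugate in G. -/

import Mathlib

open Set

/-- A topologically embedded arc in `T` joining `x` to `y`, given as a subset:
the image of a continuous injective map on `[0,1]` with endpoints `x` and `y`
(such a map is automatically a topological embedding). -/
def IsArc {T : Type*} [MetricSpace T] (A : Set T) (x y : T) : Prop :=
  ∃ f : ℝ → T, ContinuousOn f (Icc (0 : ℝ) 1) ∧ InjOn f (Icc (0 : ℝ) 1) ∧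
    f '' Icc (0 : ℝ) 1 = A ∧ f 0 = x ∧ f 1 = y

/-- `A ⊆ T` is isometric to a closed bounded interval of `ℝ`. -/
def IsIsometricToInterval {T : Type*} [MetricSpace T] (A : Set T) : Prop :=
  ∃ (a b : ℝ) (f : ℝ → T), a ≤ b ∧
    (∀ s ∈ Icc a b, ∀ t ∈ Icc a b, dist (f s) (f t) = |s - t|) ∧
    f '' Icc a b = A

/-- An `ℝ`-tree: a metric space in which any two distinct points are joined by a
unique topologically embedded arc, and this arc is isometric to a closed bounded
interval of `ℝ`. -/
structure IsRTree (T : Type*) [MetricSpace T] : Prop where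
  arc_existsUnique : ∀ ⦃x y : T⦄, x ≠ y → ∃! A : Set T, IsArc A x y
  arc_isometric : ∀ ⦃x y : T⦄, x ≠ y → ∀ A : Set T, IsArc A x y → IsIsometricToInterval A

open scoped Classical in
/-- The segment `[x,y]`: the unique arc joining `x` to `y` if `x ≠ y`
(computed as the intersection of all such arcs), and `{x}` if `x = y`. -/
noncomputable def seg {T : Type*} [MetricSpace T] (x y : T) : Set T :=
  if x = y then {x} else ⋂₀ {A : Set T | IsArc A x y}

/-- Betweenness: `Btwn x y z` iff `x ∈ [y,z] \ {y,z}`. -/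
def Btwn {T : Type*} [MetricSpace T] (x y z : T) : Prop :=
  x ∈ seg y z ∧ x ≠ y ∧ x ≠ z

/-- A weak homeomorphism of `T`: a bijection preserving the betweenness relation. -/
def IsWeakHomeo {T : Type*} [MetricSpace T] (g : T → T) : Prop :=
  Function.Bijective g ∧ ∀ x y z : T, Btwn x y z ↔ Btwn (g x) (g y) (g z)

/-- Convex subsets (subtrees) of `T`. -/
def ConvexSubtree {T : Type*} [MetricSpace T] (S : Set T) : Prop :=
  ∀ x ∈ S, ∀ y ∈ S, seg x y ⊆ S

/-- The action of `G` on `T` is by weak homeomorphisms. -/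
def ActsByWeakHomeos (G T : Type*) [Group G] [MulAction G T] [MetricSpace T] : Prop :=
  ∀ g : G, IsWeakHomeo (fun t : T => g • t)

/-- The action of `G` on `T` is non-nesting: no segment is mapped properly into itself. -/
def NonNesting (G T : Type*) [Group G] [MulAction G T] [MetricSpace T] : Prop :=
  ∀ (g : G) (x y : T), ¬ ((fun t : T => g • t) '' seg x y ⊂ seg x y)

/-- The fixed-point set `T^g` of a group element. -/
def fixedSet (T : Type*) {G : Type*} [Group G] [MulAction G T] (g : G) : Set T :=
  {t : T | g • t = t}

/-- `x, y, z` span a tripod: the median of `x, y, z` lies in none of `{x,y,z}`. -/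
def IsTripod {T : Type*} [MetricSpace T] (x y z : T) : Prop :=
  ∀ c ∈ seg x y ∩ seg y z ∩ seg z x, c ≠ x ∧ c ≠ y ∧ c ≠ z

/-- `S` contains no tripod. -/
def NoTripod {T : Type*} [MetricSpace T] (S : Set T) : Prop :=
  ¬ ∃ x y z : T, IsTripod x y z ∧ seg x y ∪ seg y z ∪ seg z x ⊆ S

/-- A line: a convex subset containing no tripod, maximal for inclusion. -/
def IsLine {T : Type*} [MetricSpace T] (L : Set T) : Prop :=
  ConvexSubtree L ∧ NoTripod L ∧
    ∀ L' : Set T, ConvexSubtree L' → NoTripod L' → L ⊆ L' → L' = L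

/-- `L` is an axis for `g`: a `g`-invariant line. -/
def IsAxis {G T : Type*} [Group G] [MulAction G T] [MetricSpace T] (g : G) (L : Set T) :
    Prop :=
  IsLine L ∧ (fun t : T => g • t) '' L = L



theorem arc_rescale {T : Type*} [MetricSpace T] {d : ℝ} (hd : 0 < d) {f : ℝ → T}
    (hc : ContinuousOn f (Icc 0 d)) (hi : InjOn f (Icc 0 d)) :
    IsArc (f '' Icc 0 d) (f 0) (f d) := by
  have hmap : ∀ t ∈ Icc (0:ℝ) 1, d * t ∈ Icc 0 d := fun t ht =>
    ⟨by nlinarith [ht.1], by nlinarith [ht.2]⟩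
  refine ⟨fun t => f (d * t), ?_, ?_, ?_, by simp, by simp⟩
  · exact hc.comp (by fun_prop) hmap
  · intro s hs t ht hst
    have := hi (hmap s hs) (hmap t ht) hst
    exact mul_left_cancel₀ hd.ne' this
  · ext z
    constructor
    · rintro ⟨t, ht, rfl⟩
      exact ⟨d * t, hmap t ht, rfl⟩
    · rintro ⟨t, ht, rfl⟩
      refine ⟨t / d, ⟨div_nonneg ht.1 hd.le, (div_le_one hd).2 ht.2⟩, ?_⟩
      have : d * (t / d) = t := by field_simp
      simp only [this]

theorem seg_eq_of_arc {T : Type*} [MetricSpace T] (hT : IsRTree T) {x y : T} (hxy : x ≠ y)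
    {A : Set T} (hA : IsArc A x y) : seg x y = A := by
  have hs : {B : Set T | IsArc B x y} = {A} := by
    ext B
    constructor
    · intro hB
      exact (hT.arc_existsUnique hxy).unique hB hA
    · rintro rfl
      exact hA
  rw [seg, if_neg hxy, hs, sInter_singleton]

theorem cont_of_isom {T : Type*} [MetricSpace T] {d : ℝ} {f : ℝ → T}
    (hf : ∀ s ∈ Icc 0 d, ∀ t ∈ Icc 0 d, dist (f s) (f t) = |s - t|) :
    ContinuousOn f (Icc 0 d) := by
  have : LipschitzOnWith 1 f (Icc 0 d) := by
    apply LipschitzOnWith.of_dist_le_mul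
    intro s hs t ht
    rw [hf s hs t ht, Real.dist_eq]
    simp
  exact this.continuousOn

theorem inj_of_isom {T : Type*} [MetricSpace T] {d : ℝ} {f : ℝ → T}
    (hf : ∀ s ∈ Icc 0 d, ∀ t ∈ Icc 0 d, dist (f s) (f t) = |s - t|) :
    InjOn f (Icc 0 d) := by
  intro s hs t ht h
  have h1 := hf s hs t ht
  rw [h, dist_self] at h1
  have := abs_eq_zero.1 h1.symm
  linarith

theorem geod {T : Type*} [MetricSpace T] (hT : IsRTree T) (x y : T) :
    ∃ f : ℝ → T, (∀ s ∈ Icc 0 (dist x y), ∀ t ∈ Icc 0 (dist x y), dist (f s) (f t) = |s - t|) ∧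
      f 0 = x ∧ f (dist x y) = y ∧ f '' Icc 0 (dist x y) = seg x y := by
  by_cases hxy : x = y
  · subst hxy
    refine ⟨fun _ => x, ?_, rfl, rfl, ?_⟩
    · intro s hs t ht
      simp only [dist_self, Icc_self, mem_singleton_iff] at hs ht
      simp [hs, ht]
    · simp [seg]
  obtain ⟨A, hA, -⟩ := hT.arc_existsUnique hxy
  obtain ⟨α, β, f, hαβ, hf, hfA⟩ := hT.arc_isometric hxy A hA
  obtain ⟨φ, -, -, hφ, h0, h1⟩ := hA
  have hx : x ∈ f '' Icc α β := by
    rw [hfA, ← hφ, ← h0]; exact mem_image_of_mem _ (by simp)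
  have hy : y ∈ f '' Icc α β := by
    rw [hfA, ← hφ, ← h1]; exact mem_image_of_mem _ (by simp)
  obtain ⟨s, hs, rfl⟩ := hx
  obtain ⟨t, ht, rfl⟩ := hy
  have key : ∀ g : ℝ → T, (∀ u ∈ Icc 0 (dist (f s) (f t)), ∀ v ∈ Icc 0 (dist (f s) (f t)),
      dist (g u) (g v) = |u - v|) → g 0 = f s → g (dist (f s) (f t)) = f t →
      g '' Icc 0 (dist (f s) (f t)) = seg (f s) (f t) := by
    intro g hg g0 g1
    have := arc_rescale (dist_pos.2 hxy) (cont_of_isom hg) (inj_of_isom hg)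
    rw [g0, g1] at this
    exact (seg_eq_of_arc hT hxy this).symm
  have hd := hf s hs t ht
  rcases le_total s t with hst | hst
  · rw [abs_of_nonpos (by linarith)] at hd
    have hg : ∀ u ∈ Icc 0 (dist (f s) (f t)), ∀ v ∈ Icc 0 (dist (f s) (f t)),
      dist (f (s + u)) (f (s + v)) = |u - v| := by
      intro u hu v hv
      rw [hf (s + u) ⟨by linarith [hu.1, hs.1], by linarith [hu.2, ht.2]⟩ (s + v)
        ⟨by linarith [hv.1, hs.1], by linarith [hv.2, ht.2]⟩]
      congr 1; ring
    have e0 : f (s + 0) = f s := by simp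
    have e1 : f (s + dist (f s) (f t)) = f t := by rw [hd]; congr 1; ring
    exact ⟨fun u => f (s + u), hg, e0, e1, key _ hg e0 e1⟩
  · rw [abs_of_nonneg (by linarith)] at hd
    have hg : ∀ u ∈ Icc 0 (dist (f s) (f t)), ∀ v ∈ Icc 0 (dist (f s) (f t)),
      dist (f (s - u)) (f (s - v)) = |u - v| := by
      intro u hu v hv
      rw [hf (s - u) ⟨by linarith [hu.2, ht.1], by linarith [hu.1, hs.2]⟩ (s - v)
        ⟨by linarith [hv.2, ht.1], by linarith [hv.1, hs.2]⟩, abs_sub_comm u v]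
      congr 1; ring
    have e0 : f (s - 0) = f s := by simp
    have e1 : f (s - dist (f s) (f t)) = f t := by rw [hd]; congr 1; ring
    exact ⟨fun u => f (s - u), hg, e0, e1, key _ hg e0 e1⟩

/-- Points of a segment split the distance. -/
theorem seg_dist {T : Type*} [MetricSpace T] (hT : IsRTree T) {x y z : T} (hz : z ∈ seg x y) :
    dist x z + dist z y = dist x y := by
  obtain ⟨f, hf, f0, f1, fs⟩ := geod hT x y
  rw [← fs] at hz
  obtain ⟨t, ht, rfl⟩ := hz
  have h1 := hf 0 ⟨le_rfl, dist_nonneg⟩ t ht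
  have h2 := hf t ht _ ⟨dist_nonneg, le_rfl⟩
  rw [f0, abs_of_nonpos (by linarith [ht.1])] at h1
  rw [f1, abs_of_nonpos (by linarith [ht.2])] at h2
  linarith

/-- Two points on a segment. -/
theorem seg_dist2 {T : Type*} [MetricSpace T] (hT : IsRTree T) {x y z w : T}
    (hz : z ∈ seg x y) (hw : w ∈ seg x y) : dist z w = |dist x z - dist x w| := by
  obtain ⟨f, hf, f0, f1, fs⟩ := geod hT x y
  rw [← fs] at hz hw
  obtain ⟨t, ht, rfl⟩ := hz
  obtain ⟨s, hs, rfl⟩ := hw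
  have h1 := hf 0 ⟨le_rfl, dist_nonneg⟩ t ht
  have h2 := hf 0 ⟨le_rfl, dist_nonneg⟩ s hs
  rw [f0, abs_of_nonpos (by linarith [ht.1])] at h1
  rw [f0, abs_of_nonpos (by linarith [hs.1])] at h2
  rw [hf t ht s hs, h1, h2]
  congr 1; ring

theorem seg_point {T : Type*} [MetricSpace T] (hT : IsRTree T) (x y : T) {t : ℝ}
    (h0 : 0 ≤ t) (h1 : t ≤ dist x y) : ∃ z ∈ seg x y, dist x z = t := by
  obtain ⟨f, hf, f0, f1, fs⟩ := geod hT x y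
  refine ⟨f t, fs ▸ mem_image_of_mem _ ⟨h0, h1⟩, ?_⟩
  have := hf 0 ⟨le_rfl, dist_nonneg⟩ t ⟨h0, h1⟩
  rw [f0, abs_of_nonpos (by linarith)] at this
  linarith

theorem left_mem {T : Type*} [MetricSpace T] (hT : IsRTree T) (x y : T) : x ∈ seg x y := by
  obtain ⟨f, hf, f0, f1, fs⟩ := geod hT x y
  rw [← fs]; exact ⟨0, ⟨le_rfl, dist_nonneg⟩, f0⟩

theorem right_mem {T : Type*} [MetricSpace T] (hT : IsRTree T) (x y : T) : y ∈ seg x y := by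
  obtain ⟨f, hf, f0, f1, fs⟩ := geod hT x y
  rw [← fs]; exact ⟨_, ⟨dist_nonneg, le_rfl⟩, f1⟩

theorem seg_compact {T : Type*} [MetricSpace T] (hT : IsRTree T) (x y : T) :
    IsCompact (seg x y) := by
  obtain ⟨f, hf, f0, f1, fs⟩ := geod hT x y
  rw [← fs]; exact isCompact_Icc.image_of_continuousOn (cont_of_isom hf)

theorem seg_comm {T : Type*} [MetricSpace T] (hT : IsRTree T) (x y : T) :
    seg x y = seg y x := by
  by_cases hxy : x = y
  · rw [hxy]
  obtain ⟨A, ⟨f, hc, hi, him, h0, h1⟩, -⟩ := hT.arc_existsUnique hxy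
  rw [seg_eq_of_arc hT hxy ⟨f, hc, hi, him, h0, h1⟩]
  symm
  apply seg_eq_of_arc hT (Ne.symm hxy)
  have hm : ∀ t ∈ Icc (0:ℝ) 1, 1 - t ∈ Icc (0:ℝ) 1 := fun t ht =>
    ⟨by linarith [ht.2], by linarith [ht.1]⟩
  refine ⟨fun t => f (1 - t), hc.comp (by fun_prop) hm, ?_, ?_, by simpa, by simpa⟩
  · intro s hs t ht hst
    have := hi (hm s hs) (hm t ht) hst
    linarith
  · rw [← him]
    ext z
    constructor
    · rintro ⟨t, ht, rfl⟩
      exact ⟨1 - t, hm t ht, rfl⟩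
    · rintro ⟨t, ht, rfl⟩
      exact ⟨1 - t, hm t ht, by simp⟩

theorem seg_concat {T : Type*} [MetricSpace T] (hT : IsRTree T) {x m y : T}
    (hm : ∀ w ∈ seg x m, w ∈ seg m y → w = m) :
    m ∈ seg x y ∧ seg x m ⊆ seg x y := by
  by_cases hxm : x = m
  · subst hxm
    refine ⟨left_mem hT _ _, ?_⟩
    intro w hw
    simp only [seg, if_true, mem_singleton_iff] at hw
    subst hw; exact left_mem hT _ _
  have hxy : x ≠ y := by
    rintro rfl
    exact hxm (hm x (left_mem hT _ _) (right_mem hT _ _))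
  obtain ⟨f, hf, f0, f1, fs⟩ := geod hT x m
  obtain ⟨g, hg, g0, g1, gs⟩ := geod hT m y
  set d1 := dist x m
  set d2 := dist m y
  have hd1 : 0 < d1 := dist_pos.2 hxm
  have hd2 : 0 ≤ d2 := dist_nonneg
  let F : ℝ → T := fun s => if s ≤ d1 then f s else g (s - d1)
  have hF1 : ∀ s ∈ Icc 0 d1, F s = f s := fun s hs => if_pos hs.2
  have hF2 : ∀ s ∈ Icc d1 (d1 + d2), F s = g (s - d1) := by
    intro s hs
    by_cases h : s ≤ d1
    · have : s = d1 := le_antisymm h hs.1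
      subst this
      simp only [F, le_refl, if_true, sub_self, f1, g0]
    · exact if_neg h
  have hun : Icc 0 (d1 + d2) = Icc 0 d1 ∪ Icc d1 (d1 + d2) :=
    (Icc_union_Icc_eq_Icc hd1.le (by linarith)).symm
  have hsh : ∀ s ∈ Icc d1 (d1 + d2), s - d1 ∈ Icc 0 d2 := fun s hs =>
    ⟨by linarith [hs.1], by linarith [hs.2]⟩
  have hFc : ContinuousOn F (Icc 0 (d1 + d2)) := by
    rw [hun]
    apply ContinuousOn.union_of_isClosed _ _ isClosed_Icc isClosed_Icc
    · exact (cont_of_isom hf).congr hF1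
    · exact ((cont_of_isom hg).comp (by fun_prop) hsh).congr hF2
  have hmix : ∀ s ∈ Icc 0 d1, ∀ t ∈ Icc d1 (d1 + d2), F s = F t → s = t := by
    intro s hs t ht hst
    rw [hF1 s hs, hF2 t ht] at hst
    have h1 : f s = m := hm _ (fs ▸ mem_image_of_mem _ hs)
      (hst ▸ gs ▸ mem_image_of_mem _ (hsh t ht))
    have e1 := inj_of_isom hf hs ⟨hd1.le, le_rfl⟩ (h1.trans f1.symm)
    have e2 := inj_of_isom hg (hsh t ht) ⟨le_rfl, hd2⟩ ((hst.symm.trans h1).trans g0.symm)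
    linarith
  have hFi : InjOn F (Icc 0 (d1 + d2)) := by
    intro s hs t ht hst
    rw [hun] at hs ht
    rcases hs with hs | hs <;> rcases ht with ht | ht
    · rw [hF1 s hs, hF1 t ht] at hst
      exact inj_of_isom hf hs ht hst
    · exact hmix s hs t ht hst
    · exact (hmix t ht s hs hst.symm).symm
    · rw [hF2 s hs, hF2 t ht] at hst
      have := inj_of_isom hg (hsh s hs) (hsh t ht) hst
      linarith
  have harc := arc_rescale (by linarith) hFc hFi
  have e0 : F 0 = x := by rw [hF1 0 ⟨le_rfl, hd1.le⟩, f0]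
  have e1 : F (d1 + d2) = y := by
    rw [hF2 _ ⟨by linarith, le_rfl⟩, add_sub_cancel_left, g1]
  rw [e0, e1] at harc
  rw [seg_eq_of_arc hT hxy harc]
  refine ⟨⟨d1, ⟨hd1.le, by linarith⟩, ?_⟩, ?_⟩
  · rw [hF1 _ ⟨hd1.le, le_rfl⟩, f1]
  · rw [← fs]
    rintro _ ⟨s, hs, rfl⟩
    exact ⟨s, ⟨hs.1, by linarith [hs.2]⟩, hF1 s hs⟩

theorem seg_sub {T : Type*} [MetricSpace T] (hT : IsRTree T) {x y z : T} (hz : z ∈ seg x y) :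
    seg x z ⊆ seg x y := by
  apply (seg_concat hT _).2
  -- points in both pieces
  by_cases hxz : x = z
  · subst hxz
    intro w hw _
    simpa [seg] using hw
  obtain ⟨f, hf, f0, f1, fs⟩ := geod hT x y
  rw [← fs] at hz
  obtain ⟨t, ht, rfl⟩ := hz
  have ht0 : 0 < t := lt_of_le_of_ne ht.1 (by rintro rfl; exact hxz f0.symm)
  have r1 : ∀ w ∈ seg x (f t), ∃ s ∈ Icc 0 t, f s = w := by
    have hf' : ∀ s ∈ Icc 0 t, ∀ u ∈ Icc 0 t, dist (f s) (f u) = |s - u| := fun s hs u hu =>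
      hf s ⟨hs.1, hs.2.trans ht.2⟩ u ⟨hu.1, hu.2.trans ht.2⟩
    have := arc_rescale ht0 (cont_of_isom hf') (inj_of_isom hf')
    rw [f0] at this
    rw [seg_eq_of_arc hT hxz this]
    rintro w ⟨s, hs, rfl⟩; exact ⟨s, hs, rfl⟩
  intro w hw hw2
  obtain ⟨s, hs, rfl⟩ := r1 w hw
  have a1 := seg_dist hT hw2
  have hs' : s ∈ Icc 0 (dist x y) := ⟨hs.1, hs.2.trans ht.2⟩
  have hl : dist x y ∈ Icc 0 (dist x y) := ⟨dist_nonneg, le_rfl⟩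
  have b1 := hf t ht s hs'
  have b2 := hf s hs' _ hl
  have b3 := hf t ht _ hl
  rw [f1] at b2 b3
  rw [abs_of_nonneg (by linarith [hs.2])] at b1
  rw [abs_of_nonpos (by linarith [hs'.2])] at b2
  rw [abs_of_nonpos (by linarith [ht.2])] at b3
  congr 1
  linarith

theorem median {T : Type*} [MetricSpace T] (hT : IsRTree T) (x y z : T) :
    ∃ m, m ∈ seg x y ∧ m ∈ seg x z ∧ m ∈ seg y z := by
  obtain ⟨m, ⟨hm1, hm2⟩, hmax⟩ := ((seg_compact hT x y).inter (seg_compact hT x z)).exists_isMaxOn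
    ⟨x, left_mem hT _ _, left_mem hT _ _⟩ (f := fun w => dist x w) (by fun_prop)
  refine ⟨m, hm1, hm2, (seg_concat hT ?_).1⟩
  intro w hw1 hw2
  have k1 : w ∈ seg x y := by
    rw [seg_comm hT] at hm1 ⊢
    exact seg_sub hT hm1 hw1
  have k2 : w ∈ seg x z := by
    rw [seg_comm hT] at hm2 ⊢
    rw [seg_comm hT] at hw2
    exact seg_sub hT hm2 hw2
  have h3 : dist x w ≤ dist x m := hmax ⟨k1, k2⟩
  have h4 := seg_dist hT hw2
  have h5 := seg_dist hT k2
  have h6 := seg_dist hT hm2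
  have : dist m w = 0 := by linarith [dist_nonneg (x := m) (y := w)]
  exact (dist_eq_zero.1 this).symm

theorem mem_seg {T : Type*} [MetricSpace T] (hT : IsRTree T) {x y z : T} :
    z ∈ seg x y ↔ dist x z + dist z y = dist x y := by
  refine ⟨seg_dist hT, fun h => ?_⟩
  obtain ⟨m, h1, h2, h3⟩ := median hT x y z
  have e1 := seg_dist hT h1
  have e2 := seg_dist hT h2
  have e3 := seg_dist hT h3
  have := dist_comm y z
  have := dist_comm y m
  have : dist m z = 0 := by linarith
  rw [← dist_eq_zero.1 this]; exact h1

theorem seg_total {T : Type*} [MetricSpace T] (hT : IsRTree T) {x y z w : T}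
    (hz : z ∈ seg x y) (hw : w ∈ seg x y) (h : dist x z ≤ dist x w) : z ∈ seg x w := by
  rw [mem_seg hT, seg_dist2 hT hz hw, abs_of_nonpos (by linarith)]; ring

/-- If `z ∈ [x,y]` and `w ∈ [x,z]` then `w ∈ [x,y]` and `z ∈ [w,y]`. -/
theorem seg_trans {T : Type*} [MetricSpace T] (hT : IsRTree T) {x y z w : T}
    (hz : z ∈ seg x y) (hw : w ∈ seg x z) : w ∈ seg x y ∧ z ∈ seg w y := by
  simp only [mem_seg hT] at *
  have := dist_triangle x w y
  have := dist_triangle w z y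
  constructor <;> linarith

theorem seg_antisymm {T : Type*} [MetricSpace T] (hT : IsRTree T) {x z w : T}
    (hz : z ∈ seg x w) (hw : w ∈ seg x z) : z = w := by
  rw [mem_seg hT] at *
  have := dist_comm z w
  exact dist_eq_zero.1 (by linarith [dist_nonneg (x := z) (y := w)])

/-- Local concatenation. -/
theorem seg_glue {T : Type*} [MetricSpace T] (hT : IsRTree T) {x y z w : T}
    (hz : z ∈ seg x w) (hw : w ∈ seg z y) (hne : z ≠ w) : z ∈ seg x y := by
  obtain ⟨m, h1, h2, h3⟩ := median hT x w y
  rcases le_total (dist x z) (dist x m) with h | h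
  · exact (seg_trans hT h2 (seg_total hT hz h1 h)).1
  · exfalso
    have h4 := (seg_trans hT hz (seg_total hT h1 hz h)).2
    rw [seg_comm hT] at h4
    have h5 := (seg_trans hT h3 h4).1
    rw [mem_seg hT] at h5 hw
    have := dist_comm z w
    exact hne (dist_eq_zero.1 (by linarith [dist_nonneg (x := z) (y := w)]))

theorem act_seg {T : Type*} [MetricSpace T] (hT : IsRTree T) {G : Type*} [Group G]
    [MulAction G T] (hact : ActsByWeakHomeos G T) (g : G) {x y z : T} (hz : z ∈ seg x y) :
    g • z ∈ seg (g • x) (g • y) := by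
  by_cases h1 : z = x
  · rw [h1]; exact left_mem hT _ _
  by_cases h2 : z = y
  · rw [h2]; exact right_mem hT _ _
  exact (((hact g).2 z x y).1 ⟨hz, h1, h2⟩).1

theorem act_image {T : Type*} [MetricSpace T] (hT : IsRTree T) {G : Type*} [Group G]
    [MulAction G T] (hact : ActsByWeakHomeos G T) (g : G) (x y : T) :
    (fun t : T => g • t) '' seg x y = seg (g • x) (g • y) := by
  ext z
  constructor
  · rintro ⟨w, hw, rfl⟩
    exact act_seg hT hact g hw
  · intro hz
    refine ⟨g⁻¹ • z, ?_, by simp⟩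
    have := act_seg hT hact g⁻¹ hz
    simpa using this

/-- An element swapping two points fixes a point. -/
theorem fix_of_swap {T : Type*} [MetricSpace T] (hT : IsRTree T) {G : Type*} [Group G]
    [MulAction G T] (hact : ActsByWeakHomeos G T) (h : G) {x y : T}
    (hx : h • x = y) (hy : h • y = x) : ∃ t : T, h • t = t := by
  have hmap : ∀ p ∈ seg x y, h • p ∈ seg x y := by
    intro p hp
    have := act_seg hT hact h hp
    rwa [hx, hy, seg_comm hT] at this
  have hmapi : ∀ p ∈ seg x y, h⁻¹ • p ∈ seg x y := by
    intro p hp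
    have := act_seg hT hact h⁻¹ hp
    rwa [inv_smul_eq_iff.2 hx.symm, inv_smul_eq_iff.2 hy.symm, seg_comm hT] at this
  have hanti : ∀ p ∈ seg x y, ∀ q ∈ seg x y, dist x p ≤ dist x q →
      dist x (h • q) ≤ dist x (h • p) := by
    intro p hp q hq hpq
    have h1 := act_seg hT hact h (seg_total hT hp hq hpq)
    rw [hx] at h1
    have h2 := seg_dist hT h1
    have h3 := seg_dist hT (hmap p hp)
    have h4 := seg_dist hT (hmap q hq)
    rw [dist_comm y, dist_comm y] at h2
    linarith [dist_nonneg (x := h • p) (y := h • q)]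
  have hlt : ∀ p ∈ seg x y, ∀ q ∈ seg x y, dist x (h • p) < dist x (h • q) →
      dist x q < dist x p := by
    intro p hp q hq hpq
    by_contra! hc
    linarith [hanti p hp q hq hc]
  by_contra hno
  push Not at hno
  let S : Set ℝ := {r | ∃ p ∈ seg x y, dist x p = r ∧ dist x p ≤ dist x (h • p)}
  have hS0 : (0:ℝ) ∈ S := ⟨x, left_mem hT _ _, by simp, by simp⟩
  have hSb : BddAbove S := by
    refine ⟨dist x y, ?_⟩
    rintro _ ⟨p, hp, rfl, -⟩
    linarith [seg_dist hT hp, dist_nonneg (x := p) (y := y)]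
  have hSle : sSup S ≤ dist x y := by
    apply csSup_le ⟨0, hS0⟩
    rintro _ ⟨p, hp, rfl, -⟩
    linarith [seg_dist hT hp, dist_nonneg (x := p) (y := y)]
  obtain ⟨c, hc, hcd⟩ := seg_point hT x y (le_csSup hSb hS0) hSle
  have hhc := hmap c hc
  have hmid : ∀ p ∈ seg x y, ∀ q ∈ seg x y, dist x p < dist x q →
      ∃ e ∈ seg x y, dist x p < dist x e ∧ dist x e < dist x q := by
    intro p hp q hq hpq
    have := seg_dist hT hq
    obtain ⟨e, he, hed⟩ := seg_point hT x y (t := (dist x p + dist x q) / 2)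
      (by positivity) (by linarith [dist_nonneg (x := q) (y := y)])
    exact ⟨e, he, by linarith, by linarith⟩
  rcases lt_trichotomy (dist x c) (dist x (h • c)) with hl | hl | hl
  · obtain ⟨e, he, h1, h2⟩ := hmid _ hc _ hhc hl
    have hgt : ∀ f ∈ seg x y, dist x c < dist x f → dist x (h • f) < dist x f := by
      intro f hf hcf
      by_contra! hcon
      linarith [le_csSup hSb (show dist x f ∈ S from ⟨f, hf, rfl, hcon⟩)]
    have h3 := hgt e he h1
    have hf := hmapi e he
    have hfe : h • (h⁻¹ • e) = e := by simp
    have h4 := hlt _ hf _ hc (by rw [hfe]; exact h2)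
    have h5 := hlt _ he _ hf (by rw [hfe]; exact h3)
    have h6 := hgt _ hf h4
    rw [hfe] at h6
    linarith
  · have := seg_dist2 hT hc hhc
    rw [hl, sub_self, abs_zero, dist_eq_zero] at this
    exact hno c this.symm
  · obtain ⟨e, he, h1, h2⟩ := hmid _ hhc _ hc hl
    have hf := hmapi e he
    have hfe : h • (h⁻¹ • e) = e := by simp
    have h4 := hlt _ hc _ hf (by rw [hfe]; exact h1)
    obtain ⟨_, ⟨s, hs, rfl, hss⟩, hs2⟩ := exists_lt_of_lt_csSup ⟨0, hS0⟩
      (show max (dist x (h⁻¹ • e)) (dist x e) < sSup S by rw [← hcd]; exact max_lt h4 h2)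
    have h5 := hanti _ hf _ hs ((le_max_left _ _).trans hs2.le)
    rw [hfe] at h5
    linarith [le_max_right (dist x (h⁻¹ • e)) (dist x e)]

/-- The orbit of a translated point leaves every segment. -/
theorem no_accum {T : Type*} [MetricSpace T] (hT : IsRTree T) {G : Type*} [Group G]
    [MulAction G T] (hact : ActsByWeakHomeos G T) (h : G) (hh : ¬ ∃ t : T, h • t = t)
    (a y : T) (hab : h • a ∈ seg a (h • h • a)) (hall : ∀ n : ℕ, h ^ n • a ∈ seg a y) : False := by
  have hne : h • a ≠ h • h • a := fun e => hh ⟨h • a, e.symm⟩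
  let S : Set ℝ := range fun n : ℕ => dist a (h ^ n • a)
  have hSne : S.Nonempty := ⟨_, 0, rfl⟩
  have hle : ∀ r ∈ S, r ≤ dist a y := by
    rintro _ ⟨n, rfl⟩
    linarith [seg_dist hT (hall n), dist_nonneg (x := h ^ n • a) (y := y)]
  have hSb : BddAbove S := ⟨_, hle⟩
  have hS0 : 0 ≤ sSup S := le_csSup_of_le hSb ⟨0, rfl⟩ dist_nonneg
  obtain ⟨c, hc, hcd⟩ := seg_point hT a y hS0 (csSup_le hSne hle)
  have hup : ∀ n : ℕ, h ^ n • a ∈ seg a c := fun n =>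
    seg_total hT (hall n) hc (by rw [hcd]; exact le_csSup hSb ⟨n, rfl⟩)
  have hleast : ∀ z, (∀ n : ℕ, h ^ n • a ∈ seg a z) → c ∈ seg a z := by
    intro z hz
    obtain ⟨m, h1, h2, h3⟩ := median hT a y z
    have key : ∀ n : ℕ, dist a (h ^ n • a) ≤ dist a m := by
      intro n
      by_contra! hcon
      have k1 := (seg_trans hT (hall n) (seg_total hT h1 (hall n) hcon.le)).2
      have k2 := (seg_trans hT (hz n) (seg_total hT h2 (hz n) hcon.le)).2
      rw [mem_seg hT] at k1 k2 h3
      have := dist_triangle y (h ^ n • a) z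
      have := dist_comm y m
      have := dist_comm y (h ^ n • a)
      have : dist m (h ^ n • a) = 0 := by linarith [dist_nonneg (x := m) (y := h ^ n • a)]
      rw [dist_eq_zero.1 this] at hcon
      exact lt_irrefl _ hcon
    have hcm : dist a c ≤ dist a m := by
      rw [hcd]
      apply csSup_le hSne
      rintro _ ⟨n, rfl⟩
      exact key n
    exact (seg_trans hT h2 (seg_total hT hc h1 hcm)).1
  have hmono : ∀ n : ℕ, h • a ∈ seg a (h ^ (n + 1) • a) := by
    intro n
    induction n with
    | zero => simpa using right_mem hT _ _
    | succ n ih =>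
      have h2 := act_seg hT hact h ih
      rw [← mul_smul h (h ^ (n + 1)), ← pow_succ'] at h2
      exact seg_glue hT hab h2 hne
  have hA : c ∈ seg a (h • c) := by
    apply hleast
    have h2 : h • h • a ∈ seg (h • a) (h • c) := by
      have := act_seg hT hact h (hup 1)
      simpa using this
    have h1 : h • a ∈ seg a (h • c) := seg_glue hT hab h2 hne
    intro n
    rcases n with _ | n
    · simpa using left_mem hT _ _
    · have h3 := act_seg hT hact h (hup n)
      rw [← mul_smul, ← pow_succ'] at h3
      rw [seg_comm hT] at h1 h3 ⊢
      exact (seg_trans hT h1 h3).1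
  have hB : c ∈ seg a (h⁻¹ • c) := by
    apply hleast
    intro n
    have h3 := act_seg hT hact h⁻¹ (hup (n + 1))
    rw [← mul_smul, pow_succ', inv_mul_cancel_left] at h3
    have h4 : a ∈ seg (h⁻¹ • a) (h ^ n • a) := by
      have := act_seg hT hact h⁻¹ (hmono n)
      rwa [inv_smul_smul, ← mul_smul, pow_succ', inv_mul_cancel_left] at this
    exact (seg_trans hT h3 h4).2
  have hB' : h • c ∈ seg a c := by
    have h1 := act_seg hT hact h hB
    rw [smul_inv_smul] at h1
    have h2 := hup 1
    rw [pow_one] at h2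
    rw [seg_comm hT] at h1 h2 ⊢
    exact (seg_trans hT h2 h1).1
  exact hh ⟨c, (seg_antisymm hT hA hB').symm⟩

theorem seg_glue' {T : Type*} [MetricSpace T] (hT : IsRTree T) {x y z w : T}
    (hz : z ∈ seg x w) (hw : w ∈ seg z y) (hne : z ≠ w) : w ∈ seg x y := by
  rw [seg_comm hT] at hz hw ⊢
  exact seg_glue hT hw hz hne.symm

theorem seg_branch {T : Type*} [MetricSpace T] (hT : IsRTree T) {b u v w : T}
    (hw : w ∈ seg u v) (hn : w ∉ seg b u) : w ∈ seg b v := by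
  obtain ⟨m, h1, h2, h3⟩ := median hT u v b
  rcases le_total (dist u w) (dist u m) with h | h
  · exfalso
    apply hn
    rw [seg_comm hT]
    exact (seg_trans hT h2 (seg_total hT hw h1 h)).1
  · have h4 := (seg_trans hT hw (seg_total hT h1 hw h)).2
    rw [seg_comm hT] at h4 ⊢
    exact (seg_trans hT h3 h4).1

theorem axis_pt {T : Type*} [MetricSpace T] (hT : IsRTree T) {G : Type*} [Group G]
    [MulAction G T] (hact : ActsByWeakHomeos G T) (hnn : NonNesting G T)
    (h : G) (hh : ¬ ∃ t : T, h • t = t)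
    (L : Set T) (hL : IsAxis h L) (a : T) (ha : a ∈ L) : h • a ∈ seg a (h • h • a) := by
  have h1 : h • a ∈ L := by
    rw [← hL.2]; exact mem_image_of_mem _ ha
  have h2 : h • h • a ∈ L := by
    rw [← hL.2]; exact mem_image_of_mem _ h1
  have hswap : a ≠ h • h • a := fun e => hh (fix_of_swap hT hact h rfl e.symm)
  have hno : ¬ IsTripod a (h • a) (h • h • a) := by
    intro ht
    refine hL.1.2.1 ⟨_, _, _, ht, ?_⟩
    exact union_subset (union_subset (hL.1.1 _ ha _ h1) (hL.1.1 _ h1 _ h2)) (hL.1.1 _ h2 _ ha)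
  unfold IsTripod at hno
  push Not at hno
  obtain ⟨c, ⟨⟨c1, c2⟩, c3⟩, hc⟩ := hno
  by_cases e1 : c = a
  · -- a ∈ [h a, h² a]
    exfalso
    rw [e1] at c2
    have hsub : seg (h • a) a ⊆ seg (h • a) (h • h • a) := seg_sub hT c2
    refine hnn h⁻¹ (h • a) (h • h • a) ⟨?_, ?_⟩
    · rw [act_image hT hact, inv_smul_smul, inv_smul_smul, seg_comm hT]
      exact hsub
    · rw [act_image hT hact, inv_smul_smul, inv_smul_smul]
      intro hs
      have := hs (right_mem hT _ _)
      rw [seg_comm hT] at this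
      exact hswap (seg_antisymm hT c2 this)
  by_cases e2 : c = h • a
  · rw [e2, seg_comm hT] at c3
    exact c3
  · exfalso
    have e3 := hc e1 e2
    rw [e3] at c1
    rw [seg_comm hT] at c1
    have hsub : seg (h • a) (h • h • a) ⊆ seg (h • a) a := seg_sub hT c1
    refine hnn h (h • a) a ⟨?_, ?_⟩
    · rw [act_image hT hact, seg_comm hT]
      exact hsub
    · rw [act_image hT hact]
      intro hs
      have := hs (right_mem hT _ _)
      rw [seg_comm hT] at this
      exact hswap (seg_antisymm hT this c1)

/-- For a non-nesting action by weak homeomorphisms on an `ℝ`-tree,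
if `h, h'` are loxodromic, `a` lies on the axis of `h`, and
`[a', h'² a'] ⊆ [a, h a]` for some `a'`, then `h` and `h'` are not conjugate. -/
theorem not_isConj_of_seg_subset
    {T : Type*} [MetricSpace T] (hT : IsRTree T)
    {G : Type*} [Group G] [MulAction G T]
    (hact : ActsByWeakHomeos G T) (hnn : NonNesting G T)
    (h h' : G) (hh : ¬ ∃ t : T, h • t = t) (hh' : ¬ ∃ t : T, h' • t = t)
    (L : Set T) (hL : IsAxis h L) (a : T) (ha : a ∈ L)
    (a' : T) (hsub : seg a' ((h' ^ 2) • a') ⊆ seg a (h • a)) :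
    ¬ IsConj h h' := by
  intro hconj
  obtain ⟨c, rfl⟩ := isConj_iff.1 hconj
  have hax := axis_pt hT hact hnn h hh L hL a ha
  set b : T := c⁻¹ • a' with hb
  have hbet : ∀ k : ℤ, h ^ k • a ∈ seg (h ^ (k - 1) • a) (h ^ (k + 1) • a) := by
    intro k
    have := act_seg hT hact (h ^ (k - 1)) hax
    have e1 : h ^ (k - 1) * h = h ^ k := by group
    have e2 : h ^ k * h = h ^ (k + 1) := by group
    have e3 : h ^ (k - 1) • h • a = h ^ k • a := by rw [← mul_smul, e1]
    have e4 : h ^ (k - 1) • h • h • a = h ^ (k + 1) • a := by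
      rw [← mul_smul, e1, ← mul_smul, e2]
    rwa [e3, e4] at this
  have hne : ∀ k : ℤ, h ^ k • a ≠ h ^ (k + 1) • a := by
    intro k e
    apply hh
    refine ⟨h ^ k • a, ?_⟩
    rw [← mul_smul, ← zpow_one_add, add_comm, ← e]
  let P : ℤ → Prop := fun n => h ^ n • a ∈ seg b (h ^ (n - 1) • a)
  have hQ : ∀ n, ¬ P n → h ^ n • a ∈ seg b (h ^ (n + 1) • a) := fun n hn =>
    seg_branch hT (hbet n) hn
  have hP : ∀ n, P (n + 1) → P n := by
    intro n hn
    have h1 : h ^ (n + 1) • a ∈ seg b (h ^ n • a) := by simpa [P] using hn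
    have h2 := hbet n
    rw [seg_comm hT] at h2
    exact seg_glue' hT h1 h2 (hne n).symm
  have hnot : ∃ n, ¬ P n := by
    by_contra! hall
    refine no_accum hT hact h hh a b hax ?_
    intro n
    rw [seg_comm hT]
    induction n with
    | zero => simpa using right_mem hT _ _
    | succ n ih =>
      have h1 : h ^ (n + 1) • a ∈ seg b (h ^ n • a) := by
        have := hall (n + 1)
        simp only [P, add_sub_cancel_right] at this
        exact_mod_cast this
      exact (seg_trans hT ih h1).1
  have hex : ∃ n, P n := by
    by_contra! hall
    refine no_accum hT hact h⁻¹ ?_ a b ?_ ?_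
    · rintro ⟨t, ht⟩
      exact hh ⟨t, (inv_smul_eq_iff.1 ht).symm⟩
    · have := act_seg hT hact (h⁻¹ * h⁻¹) hax
      rw [seg_comm hT] at this
      simpa [mul_smul] using this
    intro n
    rw [seg_comm hT]
    induction n with
    | zero => simpa using right_mem hT _ _
    | succ n ih =>
      have h1 := hQ _ (hall (-((n : ℤ) + 1)))
      have e1 : h ^ (-((n : ℤ) + 1)) = h⁻¹ ^ (n + 1) := by
        rw [zpow_neg, inv_pow]; norm_cast
      have e2 : h ^ (-((n : ℤ) + 1) + 1) = h⁻¹ ^ n := by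
        rw [neg_add_rev, neg_add_cancel_comm, zpow_neg, inv_pow, zpow_natCast]
      rw [e1, e2] at h1
      exact (seg_trans hT ih h1).1
  have hjump : ∃ n, P n ∧ ¬ P (n + 1) := by
    by_contra! hcon
    obtain ⟨n0, hn0⟩ := hex
    obtain ⟨n1, hn1⟩ := hnot
    have hup : ∀ k : ℕ, P (n0 + k) := by
      intro k
      induction k with
      | zero => simpa using hn0
      | succ k ih =>
        have := hcon _ ih
        rwa [add_assoc] at this
    have hdown : ∀ k : ℕ, ∀ m : ℤ, m + k = n0 → P m := by
      intro k
      induction k with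
      | zero => intro m hm; rw [← hm] at hn0; simpa using hn0
      | succ k ih =>
        intro m hm
        exact hP _ (ih (m + 1) (by push_cast at hm; linarith))
    apply hn1
    rcases le_total n0 n1 with hle | hle
    · obtain ⟨k, hk⟩ := Int.le.dest hle
      rw [← hk]; exact hup k
    · obtain ⟨k, hk⟩ := Int.le.dest hle
      exact hdown k n1 hk
  obtain ⟨n, hn, hn1⟩ := hjump
  have hu := hQ _ hn1
  set u := h ^ (n + 1) • a with hudef
  set v := h ^ (n + 1 + 1) • a with hvdef
  have hv : v ∈ seg u (h ^ 2 • b) := by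
    have := act_seg hT hact (h ^ 2) hn
    have e1 : h ^ 2 * h ^ n = h ^ (n + 1 + 1) := by
      rw [← zpow_natCast, ← zpow_add]; congr 1; push_cast; ring
    have e2 : h ^ 2 * h ^ (n - 1) = h ^ (n + 1) := by
      rw [← zpow_natCast, ← zpow_add]; congr 1; push_cast; ring
    rw [← mul_smul _ _ a, ← mul_smul _ _ a, e1, e2, seg_comm hT] at this
    exact this
  have huv : u ≠ v := hne (n + 1)
  have hv' : v ∈ seg b (h ^ 2 • b) := seg_glue' hT hu hv huv
  have hsub1 : seg u v ⊆ seg b (h ^ 2 • b) := by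
    intro p hp
    have : p ∈ seg b v := by
      rw [seg_comm hT] at hp hu ⊢
      exact (seg_trans hT hu hp).1
    exact (seg_trans hT hv' this).1
  have hbn : b ∉ seg u v := by
    intro hbuv
    rw [seg_comm hT] at hbuv
    rw [seg_comm hT] at hu
    have hbu := seg_antisymm hT hbuv hu
    apply hn1
    change h ^ (n + 1) • a ∈ seg b _
    rw [← hudef, ← hbu]
    exact left_mem hT _ _
  have ea : a' = c • b := by rw [hb, smul_inv_smul]
  have eh : (c * h * c⁻¹) ^ 2 • a' = c • h ^ 2 • b := by
    rw [conj_pow, hb, mul_smul, mul_smul]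
  rw [eh] at hsub
  have himg : (fun t : T => (c * h ^ (n + 1)) • t) '' seg a (h • a) = seg (c • u) (c • v) := by
    have e2 : h ^ (n + 1) * h = h ^ (n + 1 + 1) := by rw [zpow_add_one h (n + 1)]
    rw [act_image hT hact, mul_smul, mul_smul, ← mul_smul _ h a, e2]
  have hbig : seg (c • u) (c • v) ⊆ seg a' (c • h ^ 2 • b) := by
    rw [ea, ← act_image hT hact, ← act_image hT hact]
    exact image_mono hsub1
  refine hnn (c * h ^ (n + 1)) a (h • a) ?_
  rw [himg]
  refine ⟨hbig.trans hsub, fun hcon => hbn ?_⟩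
  have := act_seg hT hact c⁻¹ (hcon (hsub (left_mem hT _ _)))
  simpa using this
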